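/- arXiv:2410.06464 — 2 statements merged into one kernel-verified Lean document; each statement's English description precedes it below -/
import Mathlib

section
/- Let Σ be a topologically transitive one-sided Markov shift over the countable alphabet ℤ₊ and A : Σ → ℝ a potential of summable variation. Then at the critical level γ = β_A, one has φ_A(x,y) > −∞ and h_A(x,y) > −∞ for all x, y ∈ Σ. -/
open MeasureTheory Filter Set
open scoped ENNReal

namespace CMS

/-- The one-sided Markov shift `Σ` over the countable alphabet `ℕ = ℤ₊`,
determined by the transition matrix `Tr`. -/
abbrev SS (Tr : ℕ → ℕ → Prop) : Type := {x : ℕ → ℕ // ∀ n, Tr (x n) (x (n + 1))}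

/-- The left shift map `σ`. -/
def shiftMap (Tr : ℕ → ℕ → Prop) (x : SS Tr) : SS Tr :=
  ⟨fun n => x.1 (n + 1), fun n => x.2 (n + 1)⟩

open scoped Classical in
/-- The metric `d(x,y) = λ^ℓ`, `ℓ` the first index of disagreement (`0` if `x = y`). -/
noncomputable def sdist (lam : ℝ) {Tr : ℕ → ℕ → Prop} (x y : SS Tr) : ℝ :=
  if h : ∃ n, x.1 n ≠ y.1 n then lam ^ Nat.find h else 0

/-- Birkhoff sum `S_n f`. -/
noncomputable def birk {Tr : ℕ → ℕ → Prop} (f : SS Tr → ℝ) (n : ℕ) (x : SS Tr) : ℝ :=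
  ∑ i ∈ Finset.range n, f ((shiftMap Tr)^[i] x)

/-- `ℓ`-th variation of `f` restricted to a subset `s` (valued in `ℝ≥0∞`). -/
noncomputable def varAtOn (lam : ℝ) {Tr : ℕ → ℕ → Prop} (s : Set (SS Tr))
    (f : SS Tr → ℝ) (ℓ : ℕ) : ℝ≥0∞ :=
  ⨆ (x ∈ s) (y ∈ s) (_ : sdist lam x y ≤ lam ^ ℓ), ENNReal.ofReal (f x - f y)

/-- `ℓ`-th variation `Var_ℓ(f)`. -/
noncomputable def varAt (lam : ℝ) {Tr : ℕ → ℕ → Prop} (f : SS Tr → ℝ) (ℓ : ℕ) : ℝ≥0∞ :=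
  varAtOn lam Set.univ f ℓ

/-- `Var_k^∞(f) = ∑_{ℓ ≥ k} Var_ℓ(f)`. -/
noncomputable def varFrom (lam : ℝ) {Tr : ℕ → ℕ → Prop} (f : SS Tr → ℝ) (k : ℕ) : ℝ≥0∞ :=
  ∑' ℓ : ℕ, varAt lam f (k + ℓ)

/-- `f` has summable variation: `Var_1^∞(f) < ∞`. -/
def SummableVar (lam : ℝ) {Tr : ℕ → ℕ → Prop} (f : SS Tr → ℝ) : Prop :=
  varFrom lam f 1 < ⊤

/-- `f` is locally Hölder continuous: `Var_ℓ(f) ≤ C λ^ℓ` for all `ℓ ≥ 1`. -/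
def LocHolder (lam : ℝ) {Tr : ℕ → ℕ → Prop} (f : SS Tr → ℝ) : Prop :=
  ∃ C : ℝ, 0 < C ∧ ∀ ℓ : ℕ, 1 ≤ ℓ → varAt lam f ℓ ≤ ENNReal.ofReal (C * lam ^ ℓ)

/-- `‖A - B‖_sv = Var_1^∞(A-B) + ‖A-B‖_∞`. -/
noncomputable def svDist (lam : ℝ) {Tr : ℕ → ℕ → Prop} (A B : SS Tr → ℝ) : ℝ≥0∞ :=
  varFrom lam (fun x => A x - B x) 1 + ⨆ x : SS Tr, ENNReal.ofReal |A x - B x|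

/-- `A` is a potential: continuous and bounded from above. -/
def IsPotential {Tr : ℕ → ℕ → Prop} (A : SS Tr → ℝ) : Prop :=
  Continuous A ∧ BddAbove (Set.range A)

/-- Topological transitivity of the shift. -/
def TopTransitive (Tr : ℕ → ℕ → Prop) : Prop :=
  ∀ U V : Set (SS Tr), IsOpen U → IsOpen V → U.Nonempty → V.Nonempty →
    ∃ n : ℕ, ((shiftMap Tr)^[n] '' U ∩ V).Nonempty

/-- The ergodic maximizing constant `β_A`. -/
noncomputable def beta {Tr : ℕ → ℕ → Prop} (A : SS Tr → ℝ) : ℝ :=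
  sSup {r : ℝ | ∃ μ : Measure (SS Tr), IsProbabilityMeasure μ ∧
    μ.map (shiftMap Tr) = μ ∧ r = ∫ x, A x ∂μ}

/-- `μ` is an `A`-maximizing (shift-invariant Borel probability) measure. -/
def Maximizing {Tr : ℕ → ℕ → Prop} (A : SS Tr → ℝ) (μ : Measure (SS Tr)) : Prop :=
  IsProbabilityMeasure μ ∧ μ.map (shiftMap Tr) = μ ∧ ∫ x, A x ∂μ = beta A

/-- Topological support of a measure. -/
def msupport {Tr : ℕ → ℕ → Prop} (μ : Measure (SS Tr)) : Set (SS Tr) :=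
  {x | ∀ U : Set (SS Tr), IsOpen U → x ∈ U → 0 < μ U}

/-- `μ` is the uniform probability measure on a periodic orbit. -/
def PeriodicOrbitMeasure {Tr : ℕ → ℕ → Prop} (μ : Measure (SS Tr)) : Prop :=
  ∃ (y : SS Tr) (p : ℕ), 1 ≤ p ∧ (shiftMap Tr)^[p] y = y ∧
    μ = (p : ℝ≥0∞)⁻¹ • ∑ i ∈ Finset.range p, Measure.dirac ((shiftMap Tr)^[i] y)

/-- `A` is coercive: `lim_{i→∞} sup A|_[i] = -∞`. -/
def Coercive {Tr : ℕ → ℕ → Prop} (A : SS Tr → ℝ) : Prop :=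
  ∀ M : ℝ, ∃ N : ℕ, ∀ i : ℕ, N ≤ i → ∀ x : SS Tr, x.1 0 = i → A x ≤ M

/-- The Aubry set `Ω(A)`. -/
def Aubry (lam : ℝ) {Tr : ℕ → ℕ → Prop} (A : SS Tr → ℝ) : Set (SS Tr) :=
  {x | ∀ ε : ℝ, 0 < ε → ∃ (w : SS Tr) (n : ℕ), 0 < n ∧
    sdist lam x w < ε ∧ sdist lam ((shiftMap Tr)^[n] w) x < ε ∧
    -ε < (n : ℝ) * beta A - birk A n w ∧ (n : ℝ) * beta A - birk A n w < ε}

/-- The auxiliary function `𝔖^k_l(x,y)` at level `γ`. -/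
noncomputable def aux (lam : ℝ) {Tr : ℕ → ℕ → Prop} (A : SS Tr → ℝ) (γ : ℝ)
    (k l : ℕ) (x y : SS Tr) : EReal :=
  ⨅ (n : ℕ) (_ : l ≤ n) (w : SS Tr)
    (_ : sdist lam x w ≤ lam ^ k) (_ : sdist lam ((shiftMap Tr)^[n] w) y ≤ lam ^ k),
    (((n : ℝ) * γ - birk A n w : ℝ) : EReal)

/-- The Mañé potential `φ^γ_A(x,y)`. -/
noncomputable def mane (lam : ℝ) {Tr : ℕ → ℕ → Prop} (A : SS Tr → ℝ) (γ : ℝ)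
    (x y : SS Tr) : EReal :=
  ⨆ k : ℕ, aux lam A γ k 1 x y

/-- The Peierls barrier `h^γ_A(x,y)`. -/
noncomputable def peierls (lam : ℝ) {Tr : ℕ → ℕ → Prop} (A : SS Tr → ℝ) (γ : ℝ)
    (x y : SS Tr) : EReal :=
  ⨆ (k : ℕ) (l : ℕ), aux lam A γ k (l + 1) x y

theorem shiftMap_iterate_val {Tr : ℕ → ℕ → Prop} (n i : ℕ) (x : SS Tr) :
    ((shiftMap Tr)^[n] x).1 i = x.1 (i + n) := by
  induction n generalizing x with
  | zero => rfl
  | succ n ih =>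
    rw [Function.iterate_succ_apply, ih]
    exact congrArg x.1 (by omega)

theorem measurable_shiftMap (Tr : ℕ → ℕ → Prop) : Measurable (shiftMap Tr) := by
  have hval : Measurable fun (x : SS Tr) (n : ℕ) => x.1 (n + 1) :=
    measurable_pi_lambda _ fun n => (measurable_pi_apply (n + 1)).comp measurable_subtype_coe
  exact hval.subtype_mk

theorem sdist_le_pow {lam : ℝ} (hlam0 : 0 < lam) (hlam1 : lam < 1) {Tr : ℕ → ℕ → Prop}
    {x y : SS Tr} {ℓ : ℕ} (h : ∀ i < ℓ, x.1 i = y.1 i) : sdist lam x y ≤ lam ^ ℓ := by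
  classical
  unfold sdist
  split_ifs with hne
  · refine pow_le_pow_of_le_one hlam0.le hlam1.le ?_
    by_contra! hlt
    exact Nat.find_spec hne (h _ hlt)
  · positivity

theorem head_eq_of_sdist_le {lam : ℝ} (hlam1 : lam < 1) {Tr : ℕ → ℕ → Prop}
    {x y : SS Tr} (h : sdist lam x y ≤ lam) : x.1 0 = y.1 0 := by
  classical
  by_contra hne
  have hex : ∃ n, x.1 n ≠ y.1 n := ⟨0, hne⟩
  rw [sdist, dif_pos hex, (Nat.find_eq_zero hex).2 hne, pow_zero] at h
  linarith

theorem varAt_ne_top {lam : ℝ} {Tr : ℕ → ℕ → Prop} {A : SS Tr → ℝ}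
    (hA : SummableVar lam A) (ℓ : ℕ) : varAt lam A (1 + ℓ) ≠ ⊤ :=
  ((ENNReal.le_tsum ℓ).trans_lt hA).ne

theorem sub_le_varAt {lam : ℝ} (hlam0 : 0 < lam) (hlam1 : lam < 1) {Tr : ℕ → ℕ → Prop}
    {A : SS Tr → ℝ} {ℓ : ℕ} (hfin : varAt lam A ℓ ≠ ⊤) {x y : SS Tr}
    (h : ∀ i < ℓ, x.1 i = y.1 i) : A x - A y ≤ (varAt lam A ℓ).toReal := by
  rw [← ENNReal.ofReal_le_iff_le_toReal hfin]
  exact le_iSup₂_of_le x (mem_univ x) <| le_iSup₂_of_le y (mem_univ y) <|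
    le_iSup_of_le (sdist_le_pow hlam0 hlam1 h) le_rfl

/-- Bounded distortion of Birkhoff sums along two orbits sharing the first `n` symbols. -/
theorem birk_sub_birk_le {lam : ℝ} (hlam0 : 0 < lam) (hlam1 : lam < 1) {Tr : ℕ → ℕ → Prop}
    {A : SS Tr → ℝ} (hA : SummableVar lam A) {n : ℕ} {x y : SS Tr}
    (h : ∀ i < n, x.1 i = y.1 i) : birk A n x - birk A n y ≤ (varFrom lam A 1).toReal := by
  have hterm : ∀ i ∈ Finset.range n,
      A ((shiftMap Tr)^[i] x) - A ((shiftMap Tr)^[i] y) ≤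
        (varAt lam A (1 + (n - 1 - i))).toReal := by
    intro i hi
    rw [Finset.mem_range] at hi
    refine sub_le_varAt hlam0 hlam1 (varAt_ne_top hA _) fun j hj => ?_
    rw [shiftMap_iterate_val, shiftMap_iterate_val]
    exact h _ (by omega)
  calc birk A n x - birk A n y
      = ∑ i ∈ Finset.range n, (A ((shiftMap Tr)^[i] x) - A ((shiftMap Tr)^[i] y)) := by
        simp only [birk, Finset.sum_sub_distrib]
    _ ≤ ∑ i ∈ Finset.range n, (varAt lam A (1 + (n - 1 - i))).toReal := Finset.sum_le_sum hterm
    _ = ∑ i ∈ Finset.range n, (varAt lam A (1 + i)).toReal :=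
        Finset.sum_range_reflect (fun i => (varAt lam A (1 + i)).toReal) n
    _ = (∑ i ∈ Finset.range n, varAt lam A (1 + i)).toReal :=
        (ENNReal.toReal_sum fun i _ => varAt_ne_top hA i).symm
    _ ≤ (varFrom lam A 1).toReal := ENNReal.toReal_mono hA.ne (ENNReal.sum_le_tsum _)

theorem birk_add {Tr : ℕ → ℕ → Prop} (A : SS Tr → ℝ) (n m : ℕ) (x : SS Tr) :
    birk A (n + m) x = birk A n x + birk A m ((shiftMap Tr)^[n] x) := by
  simp only [birk, Finset.sum_range_add, ← Function.iterate_add_apply, Nat.add_comm]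

theorem bddAbove_integrals {Tr : ℕ → ℕ → Prop} {A : SS Tr → ℝ} (hA : BddAbove (range A)) :
    BddAbove {r : ℝ | ∃ μ : Measure (SS Tr), IsProbabilityMeasure μ ∧
      μ.map (shiftMap Tr) = μ ∧ r = ∫ x, A x ∂μ} := by
  obtain ⟨M, hM⟩ := hA
  refine ⟨max M 0, ?_⟩
  rintro r ⟨μ, hμ, -, rfl⟩
  by_cases hint : Integrable A μ
  · calc ∫ x, A x ∂μ ≤ ∫ _, M ∂μ :=
          integral_mono hint (integrable_const M) fun x => hM (mem_range_self x)
      _ = M := by simp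
      _ ≤ max M 0 := le_max_left _ _
  · rw [integral_undef hint]
    exact le_max_right _ _

theorem birk_le_mul_beta_of_periodic {Tr : ℕ → ℕ → Prop} {A : SS Tr → ℝ}
    (hA : BddAbove (range A)) {N : ℕ} (hN : 0 < N) {p : SS Tr}
    (hp : (shiftMap Tr)^[N] p = p) : birk A N p ≤ N * beta A := by
  have hN0 : (N : ℝ≥0∞) ≠ 0 := by exact_mod_cast hN.ne'
  let ν : Measure (SS Tr) := ∑ i ∈ Finset.range N, Measure.dirac ((shiftMap Tr)^[i] p)
  have hprob : IsProbabilityMeasure ((N : ℝ≥0∞)⁻¹ • ν) := by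
    constructor
    simp [ν, Measure.finsetSum_apply, ENNReal.inv_mul_cancel hN0 (ENNReal.natCast_ne_top N)]
  have hinv : ν.map (shiftMap Tr) = ν := by
    have hmap : ν.map (shiftMap Tr) =
        ∑ i ∈ Finset.range N, Measure.dirac ((shiftMap Tr)^[i + 1] p) := by
      rw [← Measure.mapₗ_apply_of_measurable (measurable_shiftMap Tr), map_sum]
      refine Finset.sum_congr rfl fun i _ => ?_
      rw [Measure.mapₗ_apply_of_measurable (measurable_shiftMap Tr),
        Measure.map_dirac' (measurable_shiftMap Tr), Function.iterate_succ_apply']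
    obtain ⟨K, rfl⟩ := Nat.exists_eq_succ_of_ne_zero hN.ne'
    rw [hmap, Finset.sum_range_succ, hp]
    exact (Finset.sum_range_succ' (fun i => Measure.dirac ((shiftMap Tr)^[i] p)) K).symm
  have hval : ∫ x, A x ∂((N : ℝ≥0∞)⁻¹ • ν) = (N : ℝ)⁻¹ * birk A N p := by
    rw [integral_smul_measure, integral_finsetSum_measure fun i _ => integrable_dirac (by simp)]
    simp [birk]
  have hle : (N : ℝ)⁻¹ * birk A N p ≤ beta A :=
    le_csSup (bddAbove_integrals hA)
      ⟨(N : ℝ≥0∞)⁻¹ • ν, hprob, by rw [Measure.map_smul, hinv], hval.symm⟩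
  rwa [inv_mul_le_iff₀ (by exact_mod_cast hN)] at hle

theorem exists_concat {Tr : ℕ → ℕ → Prop} (w u : SS Tr) {n : ℕ} (h : w.1 n = u.1 0) :
    ∃ q : SS Tr, (∀ i ≤ n, q.1 i = w.1 i) ∧ ∀ i, q.1 (i + n) = u.1 i := by
  refine ⟨⟨fun i => if i < n then w.1 i else u.1 (i - n), fun i => ?_⟩, fun i hi => ?_,
    fun i => by simp⟩
  · rcases lt_trichotomy (i + 1) n with hi | hi | hi
    · simpa [hi, show i < n by omega] using w.2 i
    · subst hi
      simpa [h] using w.2 i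
    · simpa [show ¬ i + 1 < n by omega, show ¬ i < n by omega,
        show i + 1 - n = i - n + 1 by omega] using u.2 (i - n)
  · rcases hi.lt_or_eq with hi | rfl
    · simp [hi]
    · simp [h]

theorem exists_periodic {Tr : ℕ → ℕ → Prop} (q : SS Tr) {N : ℕ} (hN : 0 < N)
    (hq : q.1 N = q.1 0) :
    ∃ p : SS Tr, (shiftMap Tr)^[N] p = p ∧ ∀ i < N, p.1 i = q.1 i := by
  refine ⟨⟨fun i => q.1 (i % N), fun i => ?_⟩, ?_, fun i hi => by simp [Nat.mod_eq_of_lt hi]⟩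
  · have hstep := q.2 (i % N)
    have hlt := Nat.mod_lt i hN
    beta_reduce
    rw [← Nat.mod_add_mod i N 1]
    rcases Nat.lt_or_ge (i % N + 1) N with hi | hi
    · rwa [Nat.mod_eq_of_lt hi]
    · have heq : i % N + 1 = N := by omega
      rw [heq, hq] at hstep
      rwa [heq, Nat.mod_self]
  · ext i
    simp [shiftMap_iterate_val]

theorem exists_path {Tr : ℕ → ℕ → Prop} (htr : TopTransitive Tr) (x y : SS Tr) :
    ∃ (u : SS Tr) (m : ℕ), u.1 0 = y.1 0 ∧ u.1 m = x.1 0 := by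
  have hopen : ∀ a : ℕ, IsOpen {z : SS Tr | z.1 0 = a} := fun a => by
    have hcont : Continuous fun z : SS Tr => z.1 0 :=
      (continuous_apply 0).comp continuous_subtype_val
    exact (isOpen_discrete {a}).preimage hcont
  obtain ⟨m, _, ⟨u, hu, rfl⟩, hm⟩ :=
    htr _ _ (hopen (y.1 0)) (hopen (x.1 0)) ⟨y, rfl⟩ ⟨x, rfl⟩
  refine ⟨u, m, hu, ?_⟩
  simpa [shiftMap_iterate_val] using hm

theorem bot_lt_aux_one_one {lam : ℝ} (hlam0 : 0 < lam) (hlam1 : lam < 1)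
    {Tr : ℕ → ℕ → Prop} (htr : TopTransitive Tr) {A : SS Tr → ℝ} (hA : BddAbove (range A))
    (hAsv : SummableVar lam A) (x y : SS Tr) : ⊥ < aux lam A (beta A) 1 1 x y := by
  obtain ⟨u, m, hu0, hum⟩ := exists_path htr x y
  let V := (varFrom lam A 1).toReal
  refine (EReal.bot_lt_coe (birk A m u - 2 * V - m * beta A)).trans_le ?_
  refine le_iInf₂ fun n hn => le_iInf₂ fun w hxw => le_iInf fun hwy => ?_
  rw [EReal.coe_le_coe_iff]
  rw [pow_one] at hxw hwy
  have hw0 := head_eq_of_sdist_le hlam1 hxw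
  have hwn := head_eq_of_sdist_le hlam1 hwy
  rw [shiftMap_iterate_val, zero_add] at hwn
  obtain ⟨q, hqw, hqu⟩ := exists_concat w u (hwn.trans hu0.symm)
  have hN : 0 < n + m := by omega
  obtain ⟨p, hper, hpq⟩ := exists_periodic q hN <| by
    rw [Nat.add_comm, hqu, hum, hqw 0 (Nat.zero_le n), hw0]
  have hbeta := birk_le_mul_beta_of_periodic hA hN hper
  have hwp : birk A n w - birk A n p ≤ V :=
    birk_sub_birk_le hlam0 hlam1 hAsv fun i hi => by
      rw [hpq i (by omega), hqw i hi.le]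
  have hup : birk A m u - birk A m ((shiftMap Tr)^[n] p) ≤ V :=
    birk_sub_birk_le hlam0 hlam1 hAsv fun i hi => by
      rw [shiftMap_iterate_val, hpq _ (by omega), hqu]
  rw [birk_add] at hbeta
  push_cast at hbeta
  linarith

theorem mane_peierls_above_minus_infinity
    (lam : ℝ) (hlam0 : 0 < lam) (hlam1 : lam < 1)
    (Tr : ℕ → ℕ → Prop) (htr : TopTransitive Tr)
    (A : SS Tr → ℝ) (hA : IsPotential A) (hAsv : SummableVar lam A) :
    ∀ x y : SS Tr, ⊥ < mane lam A (beta A) x y ∧ ⊥ < peierls lam A (beta A) x y := by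
  intro x y
  have h := bot_lt_aux_one_one hlam0 hlam1 htr hA.2 hAsv x y
  exact ⟨h.trans_le (le_iSup (fun k => aux lam A (beta A) k 1 x y) 1),
    h.trans_le (le_iSup₂ (f := fun k l => aux lam A (beta A) k (l + 1) x y) 1 0)⟩

end CMS
end

section
/- Let A : Σ → ℝ be a potential. Then x ∈ Ω(A) if and only if for every ε > 0 and every integer L ≥ 1 there exist a point w ∈ Σ and an integer n ≥ L such that d(x,w) < ε, d(σⁿ(w),x) < ε and −ε ≤ S_n(β_A−A)(w) ≤ ε. -/
open MeasureTheory Filter Set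
open scoped ENNReal

namespace CMS

theorem eq_of_sdist_lt_pow {lam : ℝ} (hlam0 : 0 < lam) (hlam1 : lam < 1) {Tr : ℕ → ℕ → Prop}
    {x y : SS Tr} {i : ℕ} (h : sdist lam x y < lam ^ i) : x.1 i = y.1 i := by
  classical
  by_contra hne
  have hex : ∃ n, x.1 n ≠ y.1 n := ⟨i, hne⟩
  rw [sdist, dif_pos hex] at h
  have hle : lam ^ i ≤ lam ^ Nat.find hex :=
    pow_le_pow_of_le_one hlam0.le hlam1.le (Nat.find_min' hex hne)
  exact absurd h (not_lt.mpr (by convert hle))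

theorem sdist_comm (lam : ℝ) {Tr : ℕ → ℕ → Prop} (x y : SS Tr) :
    sdist lam x y = sdist lam y x := by
  have hiff : ∀ n, x.1 n ≠ y.1 n ↔ y.1 n ≠ x.1 n := fun n => ne_comm
  by_cases h : ∃ n, x.1 n ≠ y.1 n
  · have h' : ∃ n, y.1 n ≠ x.1 n := h.imp fun n => (hiff n).mp
    rw [sdist, sdist, dif_pos h, dif_pos h', Nat.find_congr' (hiff _)]
  · have h' : ¬ ∃ n, y.1 n ≠ x.1 n := fun h' => h (h'.imp fun n => (hiff n).mpr)
    rw [sdist, sdist, dif_neg h, dif_neg h']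

theorem sdist_self (lam : ℝ) {Tr : ℕ → ℕ → Prop} (x : SS Tr) : sdist lam x x = 0 := by
  simp [sdist]

theorem tendsto_of_sdist_lt {lam : ℝ} (hlam0 : 0 < lam) (hlam1 : lam < 1) {Tr : ℕ → ℕ → Prop}
    {x : SS Tr} {w : ℕ → SS Tr} {δ : ℕ → ℝ} (hδ : Tendsto δ atTop (nhds 0))
    (h : ∀ k, sdist lam x (w k) < δ k) : Tendsto w atTop (nhds x) := by
  rw [tendsto_subtype_rng, tendsto_pi_nhds]
  intro i
  refine tendsto_const_nhds.congr' ?_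
  filter_upwards [hδ.eventually_lt_const (pow_pos hlam0 i)] with k hk
  exact eq_of_sdist_lt_pow hlam0 hlam1 ((h k).trans hk)

theorem continuous_shiftMap (Tr : ℕ → ℕ → Prop) : Continuous (shiftMap Tr) :=
  Continuous.subtype_mk (f := fun (x : SS Tr) n => x.1 (n + 1))
    (continuous_pi fun n => (continuous_apply (n + 1)).comp continuous_subtype_val) _

theorem continuous_birk {Tr : ℕ → ℕ → Prop} {f : SS Tr → ℝ} (hf : Continuous f) (n : ℕ) :
    Continuous (birk f n) :=
  continuous_finsetSum _ fun i _ => hf.comp ((continuous_shiftMap Tr).iterate i)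

theorem birk_mul_of_iterate_eq {Tr : ℕ → ℕ → Prop} (f : SS Tr → ℝ) {n : ℕ} {x : SS Tr}
    (hx : (shiftMap Tr)^[n] x = x) (m : ℕ) : birk f (m * n) x = m * birk f n x := by
  induction m with
  | zero => simp [birk]
  | succ m ih =>
    have hper : (shiftMap Tr)^[m * n] x = x := by
      rw [mul_comm, Function.iterate_mul]
      exact Function.iterate_fixed hx m
    have hadd : birk f (m * n + n) x = birk f (m * n) x + birk f n x := by
      simp only [birk, Finset.sum_range_add]
      congr 1
      refine Finset.sum_congr rfl fun i _ => ?_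
      rw [add_comm, Function.iterate_add_apply, hper]
    rw [Nat.succ_mul, hadd, ih]
    push_cast
    ring

/-- A point whose approximate returns can be realised with a fixed return time `n` is
`n`-periodic, with Birkhoff sum exactly `n * c`. -/
theorem iterate_eq_and_birk_eq_of_returns {lam : ℝ} (hlam0 : 0 < lam) (hlam1 : lam < 1)
    {Tr : ℕ → ℕ → Prop} {A : SS Tr → ℝ} (hA : Continuous A) {c : ℝ} {x : SS Tr} {n : ℕ}
    (h : ∀ δ : ℝ, 0 < δ → ∃ w : SS Tr, sdist lam x w < δ ∧
      sdist lam ((shiftMap Tr)^[n] w) x < δ ∧ |(n : ℝ) * c - birk A n w| < δ) :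
    (shiftMap Tr)^[n] x = x ∧ (n : ℝ) * c - birk A n x = 0 := by
  have hδ : Tendsto (fun k : ℕ => 1 / ((k : ℝ) + 1)) atTop (nhds 0) :=
    tendsto_one_div_add_atTop_nhds_zero_nat
  choose w hw hret hsum using fun k : ℕ => h (1 / ((k : ℝ) + 1)) Nat.one_div_pos_of_nat
  have hwx := tendsto_of_sdist_lt hlam0 hlam1 hδ hw
  refine ⟨tendsto_nhds_unique ((((continuous_shiftMap Tr).iterate n).tendsto x).comp hwx)
    (tendsto_of_sdist_lt hlam0 hlam1 hδ fun k => sdist_comm lam _ _ ▸ hret k), ?_⟩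
  exact tendsto_nhds_unique
    (((continuous_const.sub (continuous_birk hA n)).tendsto x).comp hwx)
    (squeeze_zero_norm (fun k => (hsum k).le) hδ)

theorem aubry_recurrent_characterization
    (lam : ℝ) (hlam0 : 0 < lam) (hlam1 : lam < 1)
    (Tr : ℕ → ℕ → Prop)
    (A : SS Tr → ℝ) (hA : IsPotential A) (x : SS Tr) :
    x ∈ Aubry lam A ↔
      ∀ ε : ℝ, 0 < ε → ∀ L : ℕ, 1 ≤ L → ∃ (w : SS Tr) (n : ℕ), L ≤ n ∧
        sdist lam x w < ε ∧ sdist lam ((shiftMap Tr)^[n] w) x < ε ∧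
        -ε ≤ (n : ℝ) * beta A - birk A n w ∧ (n : ℝ) * beta A - birk A n w ≤ ε := by
  constructor
  · intro hx ε hε L hL
    by_cases hfix : ∃ n, 0 < n ∧ ∀ δ : ℝ, 0 < δ → ∃ w : SS Tr, sdist lam x w < δ ∧
        sdist lam ((shiftMap Tr)^[n] w) x < δ ∧ |(n : ℝ) * beta A - birk A n w| < δ
    · obtain ⟨n, hn, h⟩ := hfix
      obtain ⟨hper, hsum⟩ := iterate_eq_and_birk_eq_of_returns hlam0 hlam1 hA.1 h
      have hperL : (shiftMap Tr)^[L * n] x = x := by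
        rw [mul_comm, Function.iterate_mul]
        exact Function.iterate_fixed hper L
      have hsumL : ((L * n : ℕ) : ℝ) * beta A - birk A (L * n) x = 0 := by
        rw [birk_mul_of_iterate_eq A hper, Nat.cast_mul, mul_assoc, ← mul_sub, hsum, mul_zero]
      refine ⟨x, L * n, Nat.le_mul_of_pos_right L hn, ?_, ?_, ?_, ?_⟩
      · rwa [sdist_self]
      · rwa [hperL, sdist_self]
      · rw [hsumL]; linarith
      · rw [hsumL]; exact hε.le
    · push Not at hfix
      choose! δ hδ hfar using hfix
      have hsmall : ∀ᶠ η : ℝ in nhdsWithin 0 (Ioi 0), ∀ n ∈ Finset.range L, 0 < n → η < δ n := by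
        rw [Filter.eventually_all_finset]
        intro n _
        by_cases hn : 0 < n
        · filter_upwards [nhdsWithin_le_nhds (Iio_mem_nhds (hδ n hn))] with η hη _ using hη
        · exact Eventually.of_forall fun _ h => absurd h hn
      obtain ⟨η, ⟨hηδ, hηε⟩, hη⟩ := ((hsmall.and (nhdsWithin_le_nhds (Iio_mem_nhds hε))).and
        self_mem_nhdsWithin).exists
      obtain ⟨w, n, hn, hw, hret, hlo, hhi⟩ := hx η hη
      refine ⟨w, n, ?_, hw.trans hηε, hret.trans hηε,
        (neg_lt_neg hηε).le.trans hlo.le, (hhi.trans hηε).le⟩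
      by_contra hnL
      have hlt := hηδ n (Finset.mem_range.mpr (not_le.mp hnL)) hn
      exact absurd ((abs_lt.mpr ⟨hlo, hhi⟩).trans hlt)
        (not_lt.mpr (hfar n hn w (hw.trans hlt) (hret.trans hlt)))
  · intro h ε hε
    obtain ⟨w, n, hn, hw, hret, hlo, hhi⟩ := h (ε / 2) (half_pos hε) 1 le_rfl
    exact ⟨w, n, hn, by linarith, by linarith, by linarith, by linarith⟩

end CMS
end
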